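/- Let (ε_k)_{k≥1} be a sequence of real numbers with 0 < ε_k ≤ 1 for all k. Then there exist a strictly increasing sequence of natural numbers (n_k)_{k≥1} and a sequence of positive real numbers (δ_n)_{n∈ℕ} with δ_n → 0 as n → ∞, such that for every k ≥ 1 and every n with n_k ≤ n < n_{k+1} one has δ_n^(-n) ≤ ε_k · k^n. -/

import Mathlib

/-- The largest index `k` with `n k ≤ m` (or `0` if there is none) tends to infinity with `m`. -/
theorem StrictMono.tendsto_findGreatest_atTop {n : ℕ → ℕ} (hn : StrictMono n) :
    Filter.Tendsto (fun m => Nat.findGreatest (fun k => n k ≤ m) m)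
      Filter.atTop Filter.atTop := by
  refine Filter.tendsto_atTop.2 fun k => ?_
  filter_upwards [Filter.eventually_ge_atTop (n k)] with m hm
  exact Nat.le_findGreatest ((hn.id_le k).trans hm) hm

theorem StrictMono.findGreatest_le_of_lt {n : ℕ → ℕ} (hn : StrictMono n) {k m : ℕ}
    (hm : m < n (k + 1)) : Nat.findGreatest (fun j => n j ≤ m) m ≤ k := by
  by_contra! h
  have hspec : n (Nat.findGreatest (fun j => n j ≤ m) m) ≤ m :=
    Nat.findGreatest_of_ne_zero (P := fun j => n j ≤ m) rfl (Nat.ne_zero_of_lt h)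
  exact absurd ((hn.monotone h).trans hspec) hm.not_ge

open Filter

/-- Given `0 < ε_k ≤ 1` for `k ≥ 1`, there are a strictly increasing sequence
`(n_k)` of naturals and positive reals `δ_n → 0` such that
`δ_n^(-n) ≤ ε_k · k^n` whenever `n_k ≤ n < n_{k+1}` (for `k ≥ 1`). -/
theorem stmt_1 (ε : ℕ → ℝ) (hε : ∀ k, 1 ≤ k → 0 < ε k ∧ ε k ≤ 1) :
    ∃ (n : ℕ → ℕ) (δ : ℕ → ℝ),
      StrictMono n ∧
      (∀ m, 0 < δ m) ∧
      Tendsto δ atTop (nhds 0) ∧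
      ∀ k, 1 ≤ k → ∀ m, n k ≤ m → m < n (k + 1) →
        ((δ m)⁻¹) ^ m ≤ ε k * (k : ℝ) ^ m := by
  have hpow : Tendsto (fun m : ℕ => (2 / 3 : ℝ) ^ m) atTop (nhds 0) :=
    tendsto_pow_atTop_nhds_zero_of_lt_one (by norm_num) (by norm_num)
  obtain ⟨n, hn, hnε⟩ : ∃ n : ℕ → ℕ, StrictMono n ∧
      ∀ k, 1 ≤ k → (2 / 3 : ℝ) ^ n k ≤ ε k := by
    refine extraction_forall_of_eventually
      (P := fun k N => 1 ≤ k → (2 / 3 : ℝ) ^ N ≤ ε k) fun k => ?_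
    by_cases hk : 1 ≤ k
    · filter_upwards [hpow.eventually_le_const (hε k hk).1] with N hN _ using hN
    · exact Eventually.of_forall fun N h => absurd h hk
  let K : ℕ → ℕ := fun m => Nat.findGreatest (fun k => n k ≤ m) m
  refine ⟨n, fun m => (((K m : ℝ) + 1) / 3)⁻¹, hn, fun m => by positivity, ?_, ?_⟩
  · refine Tendsto.inv_tendsto_atTop (Tendsto.atTop_div_const (by norm_num) ?_)
    exact tendsto_atTop_add_const_right _ _
      (tendsto_natCast_atTop_atTop.comp hn.tendsto_findGreatest_atTop)
  · intro k hk m hkm hmk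
    have hK : (K m : ℝ) ≤ k := mod_cast hn.findGreatest_le_of_lt hmk
    have hk' : (1 : ℝ) ≤ k := mod_cast hk
    have hε' : (2 / 3 : ℝ) ^ m ≤ ε k :=
      (pow_le_pow_of_le_one (by norm_num) (by norm_num) hkm).trans (hnε k hk)
    calc ((((K m : ℝ) + 1) / 3)⁻¹⁻¹) ^ m = (((K m : ℝ) + 1) / 3) ^ m := by rw [inv_inv]
      _ ≤ (2 / 3 * (k : ℝ)) ^ m := by
        gcongr
        linarith
      _ = (2 / 3 : ℝ) ^ m * (k : ℝ) ^ m := mul_pow _ _ _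
      _ ≤ ε k * (k : ℝ) ^ m := by gcongr
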